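/- For all k, d ∈ ℕ there exists a constant C > 0 such that for every n ∈ ℕ there exist a probability space (Ω, μ), measurable maps x₁,…,xₙ : Ω → (0,1)^d and a₁,…,aₙ : Ω → ℝ such that sup_{f ∈ F^k_d} ∫_Ω | ∫_{(0,1)^d} f(x) dx − Σ_{i=1}^n aᵢ(ω) f(xᵢ(ω)) | dμ(ω) ≤ C · n^{−k/d − 1/2}. -/

import Mathlib

open MeasureTheory

/-- Iterated partial derivative in coordinate direction `i`. -/
noncomputable def pderiv' (d : ℕ) (i : Fin d) (f : (Fin d → ℝ) → ℝ) : (Fin d → ℝ) → ℝ :=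
  fun x => fderiv ℝ f x (Pi.single i 1)

/-- The partial derivative `D^α f` for a multi-index `α`. -/
noncomputable def mderiv (d : ℕ) (α : Fin d → ℕ) (f : (Fin d → ℝ) → ℝ) : (Fin d → ℝ) → ℝ :=
  ((List.finRange d).flatMap fun i => List.replicate (α i) i).foldr (pderiv' d) f

/-- The open unit cube `(0,1)^d`. -/
def unitCube (d : ℕ) : Set (Fin d → ℝ) := Set.univ.pi fun _ => Set.Ioo 0 1

/-- The class `F^k_d(D)` of `C^k` functions with all partial derivatives of order `≤ k`
bounded by one on `D`. -/
def Fkd (k d : ℕ) (D : Set (Fin d → ℝ)) : Set ((Fin d → ℝ) → ℝ) :=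
  { f | ContDiffOn ℝ k f D ∧
      ∀ α : Fin d → ℕ, (∑ i, α i) ≤ k → ∀ x ∈ D, |mderiv d α f x| ≤ 1 }

/-- The `n`-th minimal worst-case error of numerical integration on the class `F` over `D`:
`e(n,F) = inf_{x₁,…,xₙ ∈ D} sup{ ∫_D f : f ∈ F, f(x₁) = ⋯ = f(xₙ) = 0 }`. -/
noncomputable def interr {d : ℕ} (D : Set (Fin d → ℝ))
    (F : Set ((Fin d → ℝ) → ℝ)) (n : ℕ) : ℝ :=
  ⨅ x : Fin n → D, sSup ((fun f => ∫ t in D, f t) ''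
    {f | f ∈ F ∧ ∀ i, f ((x i : Fin d → ℝ)) = 0})

open Polynomial in
/-- Lagrange interpolation at `q + 1` nodes in `[a, b]` approximates a `C^(q+1)` function with
`(q + 1)`-st derivative bounded by one up to an error of order `(b - a) ^ (q + 1)`. -/
lemma abs_sub_sum_lagrange_basis_le {q : ℕ} {a b Λ s : ℝ} {g : ℝ → ℝ} {v : Fin (q + 1) → ℝ}
    (hab : a < b) (hg : ContDiffOn ℝ (q + 1) g (Set.Icc a b))
    (hC : ∀ y ∈ Set.Icc a b, |iteratedDerivWithin (q + 1) g (Set.Icc a b) y| ≤ 1)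
    (hv : Function.Injective v) (hvm : ∀ j, v j ∈ Set.Icc a b) (hs : s ∈ Set.Icc a b)
    (hΛ : ∑ j, |(Lagrange.basis Finset.univ v j).eval s| ≤ Λ) :
    |g s - ∑ j, (Lagrange.basis Finset.univ v j).eval s * g (v j)|
      ≤ (1 + Λ) * (b - a) ^ (q + 1) := by
  set h : ℝ := (b - a) ^ (q + 1) with hh
  have h0 : 0 ≤ h := pow_nonneg (sub_nonneg.2 hab.le) _
  obtain ⟨p, hpdeg, hp⟩ : ∃ p : ℝ[X], p.degree < (q + 1 : ℕ) ∧
      ∀ x, p.eval x = taylorWithinEval g q (Set.Icc a b) a x := by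
    refine ⟨∑ i ∈ Finset.range (q + 1),
      C ((i.factorial : ℝ)⁻¹ * iteratedDerivWithin i g (Set.Icc a b) a) * (X - C a) ^ i, ?_, ?_⟩
    · refine (degree_sum_le _ _).trans_lt ?_
      rw [Finset.sup_lt_iff (WithBot.bot_lt_coe _)]
      intro i hi
      refine lt_of_le_of_lt ((degree_mul_le _ _).trans (add_le_add degree_C_le le_rfl)) ?_
      rw [degree_pow, degree_X_sub_C]
      simpa using mod_cast Finset.mem_range.1 hi
    · intro x
      rw [taylor_within_apply, eval_finsetSum]
      refine Finset.sum_congr rfl fun i _ => ?_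
      simp
      ring
  have hrem : ∀ x ∈ Set.Icc a b, |g x - p.eval x| ≤ h := by
    intro x hx
    have hT := taylor_mean_remainder_bound hab.le hg hx hC
    rw [← hp, Real.norm_eq_abs] at hT
    refine hT.trans ?_
    rw [one_mul]
    have h1 : (x - a) ^ (q + 1) ≤ h :=
      pow_le_pow_left₀ (sub_nonneg.2 hx.1) (by linarith [hx.2]) _
    have h2 : (1 : ℝ) ≤ (q.factorial : ℝ) := by exact_mod_cast q.factorial_pos
    exact (div_le_self (pow_nonneg (sub_nonneg.2 hx.1) _) h2).trans h1
  have hrep : p.eval s = ∑ j, (Lagrange.basis Finset.univ v j).eval s * p.eval (v j) := by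
    conv_lhs => rw [Lagrange.eq_interpolate (s := Finset.univ) (v := v) (f := p) hv.injOn
      (by simpa using hpdeg)]
    rw [Lagrange.interpolate_apply, eval_finsetSum]
    refine Finset.sum_congr rfl fun j _ => ?_
    rw [eval_mul, eval_C, mul_comm]
  have hsplit : g s - ∑ j, (Lagrange.basis Finset.univ v j).eval s * g (v j)
      = (g s - p.eval s)
        - ∑ j, (Lagrange.basis Finset.univ v j).eval s * (g (v j) - p.eval (v j)) := by
    simp only [mul_sub, Finset.sum_sub_distrib]
    rw [← hrep]
    ring
  have hsum : |∑ j, (Lagrange.basis Finset.univ v j).eval s * (g (v j) - p.eval (v j))|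
      ≤ Λ * h := by
    refine (Finset.abs_sum_le_sum_abs _ _).trans ?_
    refine le_trans (Finset.sum_le_sum fun j _ => ?_)
      ((Finset.sum_mul _ _ _).symm.trans_le (mul_le_mul_of_nonneg_right hΛ h0))
    rw [abs_mul]
    exact mul_le_mul_of_nonneg_left (hrem _ (hvm j)) (abs_nonneg _)
  rw [hsplit]
  refine (abs_sub _ _).trans ?_
  linarith [hrem s hs]

/-- Lagrange basis polynomials at nodes that are `δ`-separated and within distance `L * δ` of the
evaluation point are bounded by `L ^ q`. -/
lemma abs_eval_lagrange_basis_le {q : ℕ} {δ L s : ℝ} {v : Fin (q + 1) → ℝ} (hδ : 0 < δ)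
    (hL : 0 ≤ L) (hsep : ∀ i j, i ≠ j → δ ≤ |v i - v j|) (hs : ∀ j, |s - v j| ≤ L * δ)
    (j : Fin (q + 1)) :
    |(Lagrange.basis Finset.univ v j).eval s| ≤ L ^ q := by
  rw [Lagrange.basis, Polynomial.eval_prod, Finset.abs_prod]
  calc ∏ i ∈ Finset.univ.erase j, |(Lagrange.basisDivisor (v j) (v i)).eval s|
      ≤ ∏ _i ∈ Finset.univ.erase j, L := by
        refine Finset.prod_le_prod (fun _ _ => abs_nonneg _) fun i hi => ?_
        have hij := hsep j i (Finset.ne_of_mem_erase hi).symm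
        simp only [Lagrange.basisDivisor, Polynomial.eval_mul, Polynomial.eval_C,
          Polynomial.eval_sub, Polynomial.eval_X, abs_mul, abs_inv]
        rw [inv_mul_le_iff₀ (hδ.trans_le hij), mul_comm]
        exact (hs i).trans (mul_le_mul_of_nonneg_left hij hL)
    _ = L ^ q := by simp

/-- Piecewise Lagrange interpolation on a uniform partition of the unit interval. -/
lemma exists_piecewise_interpolation (q m : ℕ) (hm : 0 < m) :
    ∃ (y : Fin m × Fin (q + 1) → ℝ) (φ : Fin m × Fin (q + 1) → ℝ → ℝ),
      (∀ p, y p ∈ Set.Ioo (0 : ℝ) 1) ∧ (∀ p, Measurable (φ p)) ∧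
      (∀ s ∈ Set.Ioo (0 : ℝ) 1, ∑ p, |φ p s| ≤ (q + 1) * (q + 2 : ℝ) ^ q) ∧
      ∀ g : ℝ → ℝ, ContDiffOn ℝ (q + 1) g (Set.Ioo 0 1) →
        (∀ s ∈ Set.Ioo (0 : ℝ) 1, |iteratedDeriv (q + 1) g s| ≤ 1) →
        ∀ s ∈ Set.Ioo (0 : ℝ) 1, |g s - ∑ p, φ p s * g (y p)|
          ≤ (1 + (q + 1) * (q + 2 : ℝ) ^ q) * ((m : ℝ)⁻¹) ^ (q + 1) := by
  have hm0 : (0 : ℝ) < m := by exact_mod_cast hm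
  have hq0 : (0 : ℝ) ≤ q := q.cast_nonneg
  obtain ⟨δ, hδ, hδm⟩ : ∃ δ : ℝ, 0 < δ ∧ (q + 2) * δ * m = 1 :=
    ⟨1 / ((q + 2) * m), by positivity, by field_simp⟩
  have hδinv : (q + 2) * δ = (m : ℝ)⁻¹ := eq_inv_of_mul_eq_one_left hδm
  set v : Fin m → Fin (q + 1) → ℝ := fun c j => c * ((q + 2) * δ) + (j + 1) * δ with hv
  set φ : Fin m × Fin (q + 1) → ℝ → ℝ := fun p s =>
    if (p.1 : ℝ) ≤ m * s ∧ m * s < p.1 + 1 then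
      (Lagrange.basis Finset.univ (v p.1) p.2).eval s else 0 with hφ
  have hvl : ∀ c j, c * ((q + 2) * δ) + δ ≤ v c j := by
    intro c j
    have : (0 : ℝ) ≤ (j : ℕ) * δ := by positivity
    simp only [hv]; linarith
  have hvu : ∀ c j, v c j ≤ c * ((q + 2) * δ) + (q + 1) * δ := by
    intro c j
    have h1 : ((j : ℕ) : ℝ) ≤ q := by exact_mod_cast Nat.lt_succ_iff.1 j.2
    have := mul_le_mul_of_nonneg_right h1 hδ.le
    simp only [hv]; linarith
  have hcell : ∀ c : Fin m, (c : ℝ) * ((q + 2) * δ) + (q + 2) * δ ≤ 1 := by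
    intro c
    have h1 : ((c : ℕ) : ℝ) + 1 ≤ m := by exact_mod_cast c.2
    have := mul_le_mul_of_nonneg_right h1 (by positivity : 0 ≤ (q + 2) * δ)
    linarith
  have hc0 : ∀ c : Fin m, 0 ≤ (c : ℝ) * ((q + 2) * δ) := fun c => by positivity
  have hvmem : ∀ c j, v c j ∈ Set.Ioo (0 : ℝ) 1 := fun c j =>
    ⟨by linarith [hvl c j, hc0 c], by linarith [hvu c j, hcell c]⟩
  have hsep : ∀ c i j, i ≠ j → δ ≤ |v c i - v c j| := by
    intro c i j hij
    have h1 : v c i - v c j = (((i : ℕ) : ℤ) - ((j : ℕ) : ℤ) : ℤ) * δ := by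
      simp only [hv]; push_cast; ring
    have h2 : (1 : ℤ) ≤ |((i : ℕ) : ℤ) - ((j : ℕ) : ℤ)| :=
      Int.one_le_abs (by have := Fin.val_ne_of_ne hij; omega)
    have h3 : (1 : ℝ) ≤ |((((i : ℕ) : ℤ) - ((j : ℕ) : ℤ) : ℤ) : ℝ)| := by exact_mod_cast h2
    rw [h1, abs_mul, abs_of_pos hδ]
    exact le_mul_of_one_le_left hδ.le h3
  have hloc : ∀ s ∈ Set.Ioo (0 : ℝ) 1, ∃ c : Fin m,
      (c : ℝ) * ((q + 2) * δ) ≤ s ∧ s ≤ c * ((q + 2) * δ) + (q + 2) * δ ∧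
      ∀ h : Fin m × Fin (q + 1) → ℝ → ℝ, (∀ p, h p 0 = 0) → ∑ p, h p (φ p s)
        = ∑ j, h (c, j) ((Lagrange.basis Finset.univ (v c) j).eval s) := by
    intro s hs
    have hms : 0 ≤ m * s := by have := hs.1; positivity
    have hlt : ⌊(m : ℝ) * s⌋₊ < m := by
      rw [Nat.floor_lt hms]
      exact mul_lt_of_lt_one_right hm0 hs.2
    have hfl := Nat.floor_le hms
    have hfu := Nat.lt_floor_add_one ((m : ℝ) * s)
    have hs' : m * s * ((q + 2) * δ) = s := by linear_combination s * hδm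
    have hpos : 0 ≤ (q + 2) * δ := by positivity
    refine ⟨⟨_, hlt⟩, ?_, ?_, ?_⟩
    · have := mul_le_mul_of_nonneg_right hfl hpos
      simpa [hs'] using this
    · have := mul_le_mul_of_nonneg_right hfu.le hpos
      rw [hs'] at this
      simp only
      linarith
    · intro h h0
      rw [Fintype.sum_prod_type, Finset.sum_eq_single ⟨_, hlt⟩]
      · refine Finset.sum_congr rfl fun j _ => ?_
        simp only [hφ]
        rw [if_pos ⟨hfl, hfu⟩]
      · intro c _ hc
        refine Finset.sum_eq_zero fun j _ => ?_
        simp only [hφ]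
        rw [if_neg, h0]
        rintro ⟨h1, h2⟩
        refine hc (Fin.ext ?_)
        exact ((Nat.floor_eq_iff hms).2 ⟨h1, h2⟩).symm
      · simp
  have hbasis : ∀ s (c : Fin m), (c : ℝ) * ((q + 2) * δ) ≤ s →
      s ≤ c * ((q + 2) * δ) + (q + 2) * δ →
      ∑ j, |(Lagrange.basis Finset.univ (v c) j).eval s| ≤ (q + 1) * (q + 2 : ℝ) ^ q := by
    intro s c h1 h2
    calc ∑ j, |(Lagrange.basis Finset.univ (v c) j).eval s|
        ≤ ∑ _j : Fin (q + 1), (q + 2 : ℝ) ^ q := by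
          refine Finset.sum_le_sum fun j _ => abs_eval_lagrange_basis_le hδ (by positivity)
            (hsep c) (fun i => ?_) j
          rw [abs_le]
          constructor <;> linarith [hvl c i, hvu c i]
      _ = (q + 1) * (q + 2 : ℝ) ^ q := by simp
  refine ⟨fun p => v p.1 p.2, φ, fun p => hvmem _ _, fun p => ?_, fun s hs => ?_, ?_⟩
  · refine Measurable.ite ?_ (Polynomial.continuous _).measurable measurable_const
    exact (measurableSet_le measurable_const (measurable_const.mul measurable_id)).inter
      (measurableSet_lt (measurable_const.mul measurable_id) measurable_const)
  · obtain ⟨c, h1, h2, h3⟩ := hloc s hs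
    rw [h3 (fun _ x => |x|) (by simp)]
    exact hbasis s c h1 h2
  · intro g hg hgd s hs
    obtain ⟨c, h1, h2, h3⟩ := hloc s hs
    rw [h3 (fun p x => x * g (v p.1 p.2)) (by simp)]
    set a := min s (c * ((q + 2) * δ) + δ) with ha
    set b := max s (c * ((q + 2) * δ) + (q + 1) * δ + δ / 2) with hb
    have hqδ : 0 ≤ q * δ := by positivity
    have hab : a < b := lt_of_le_of_lt (min_le_right _ _)
      (lt_of_lt_of_le (by linarith) (le_max_right _ _))
    have ha0 : 0 < a := lt_min hs.1 (by linarith [hc0 c])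
    have hb1 : b < 1 := max_lt hs.2 (by linarith [hcell c])
    have hba : b - a ≤ (m : ℝ)⁻¹ := by
      have h4 : c * ((q + 2) * δ) ≤ a := le_min h1 (by linarith)
      have h5 : b ≤ c * ((q + 2) * δ) + (q + 2) * δ := max_le h2 (by linarith)
      rw [← hδinv]
      linarith
    have hsub : Set.Icc a b ⊆ Set.Ioo 0 1 := fun x hx =>
      ⟨ha0.trans_le hx.1, hx.2.trans_lt hb1⟩
    have hinj : Function.Injective (v c) := by
      intro i j hij
      by_contra hne
      have := hsep c i j hne
      rw [hij, sub_self, abs_zero] at this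
      linarith
    refine (abs_sub_sum_lagrange_basis_le hab (hg.mono hsub) ?_ hinj (fun j => ⟨?_, ?_⟩)
      ⟨min_le_left _ _, le_max_left _ _⟩ (hbasis s c h1 h2)).trans ?_
    · intro x hx
      have hat : ContDiffAt ℝ ((q + 1 : ℕ) : WithTop ℕ∞) g x := by
        have := hg.contDiffAt (isOpen_Ioo.mem_nhds (hsub hx))
        exact_mod_cast this
      rw [iteratedDerivWithin_eq_iteratedDeriv (uniqueDiffOn_Icc hab) hat hx]
      exact hgd x (hsub hx)
    · exact (min_le_right _ _).trans (hvl c j)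
    · exact (hvu c j).trans (le_trans (by linarith) (le_max_right _ _))
    · have := sub_nonneg.2 hab.le
      gcongr

lemma isOpen_unitCube (d : ℕ) : IsOpen (unitCube d) :=
  isOpen_set_pi Set.finite_univ fun _ _ => isOpen_Ioo

lemma update_mem_unitCube {d : ℕ} {t : Fin d → ℝ} (ht : t ∈ unitCube d) (i : Fin d) {s : ℝ}
    (hs : s ∈ Set.Ioo (0 : ℝ) 1) : Function.update t i s ∈ unitCube d := by
  intro j _
  rcases eq_or_ne j i with rfl | hj
  · simpa using hs
  · simpa [hj] using ht j trivial

lemma mderiv_single (k d : ℕ) (i : Fin d) (f : (Fin d → ℝ) → ℝ) :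
    mderiv d (Pi.single i k) f = (pderiv' d i)^[k] f := by
  have hl : ((List.finRange d).flatMap fun j => List.replicate ((Pi.single i k : Fin d → ℕ) j) j)
      = List.replicate k i := by
    rw [List.eq_replicate_iff]
    constructor
    · rw [List.length_flatMap]
      simp only [List.length_replicate]
      rw [← Fin.sum_univ_def]
      simp
    · intro b hb
      obtain ⟨j, -, hj⟩ := List.mem_flatMap.1 hb
      obtain ⟨hj0, rfl⟩ := List.mem_replicate.1 hj
      by_contra hne
      exact hj0 (by simp [hne])
  rw [mderiv, hl]
  clear hl
  induction k with
  | zero => rfl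
  | succ k ih => rw [List.replicate_succ, List.foldr_cons, ih, Function.iterate_succ_apply']

lemma mderiv_zero (d : ℕ) (f : (Fin d → ℝ) → ℝ) : mderiv d 0 f = f := by
  have : ((List.finRange d).flatMap fun j => List.replicate ((0 : Fin d → ℕ) j) j) = [] := by
    simp
  rw [mderiv, this, List.foldr_nil]

lemma contDiffOn_slice {d k : ℕ} {f : (Fin d → ℝ) → ℝ} (hf : ContDiffOn ℝ k f (unitCube d))
    {t : Fin d → ℝ} (ht : t ∈ unitCube d) (i : Fin d) :
    ContDiffOn ℝ k (fun s => f (Function.update t i s)) (Set.Ioo 0 1) :=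
  hf.comp (contDiff_update k t i).contDiffOn fun _ hs => update_mem_unitCube ht i hs

lemma iteratedDeriv_slice {d k : ℕ} {f : (Fin d → ℝ) → ℝ}
    (hf : ContDiffOn ℝ k f (unitCube d)) {t : Fin d → ℝ} (ht : t ∈ unitCube d) (i : Fin d)
    {s : ℝ} (hs : s ∈ Set.Ioo (0 : ℝ) 1) :
    iteratedDeriv k (fun s => f (Function.update t i s)) s
      = (pderiv' d i)^[k] f (Function.update t i s) := by
  induction k generalizing f with
  | zero => simp
  | succ k ih =>
    have hf' : ContDiffOn ℝ k (pderiv' d i f) (unitCube d) := by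
      have := hf.fderiv_of_isOpen (m := k) (isOpen_unitCube d) (by norm_cast)
      exact this.clm_apply contDiffOn_const
    rw [iteratedDeriv_succ', Function.iterate_succ_apply, ← ih hf']
    refine Filter.EventuallyEq.iteratedDeriv_eq k ?_
    filter_upwards [isOpen_Ioo.mem_nhds hs] with r hr
    have hd : HasFDerivAt f (fderiv ℝ f (Function.update t i r)) (Function.update t i r) :=
      ((hf.contDiffAt ((isOpen_unitCube d).mem_nhds (update_mem_unitCube ht i hr))).differentiableAt
        (by norm_cast)).hasFDerivAt
    exact (hd.comp_hasDerivAt r (hasDerivAt_update t i r)).deriv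

/-- Tensor products of a univariate approximation: replacing the coordinates in `S` one at a time by
nodes gives an approximation whose error grows at most by a factor `#S * Λ ^ #S`. -/
lemma exists_tensor_approximation {d : ℕ} {κ : Type} [Fintype κ] {y : κ → ℝ} {φ : κ → ℝ → ℝ}
    {Λ ε : ℝ} (hΛ : 1 ≤ Λ) (hε : 0 ≤ ε) (F : Set ((Fin d → ℝ) → ℝ))
    (hy : ∀ j, y j ∈ Set.Ioo (0 : ℝ) 1) (hφ : ∀ j, Measurable (φ j))
    (hsum : ∀ s ∈ Set.Ioo (0 : ℝ) 1, ∑ j, |φ j s| ≤ Λ)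
    (happ : ∀ f ∈ F, ∀ t ∈ unitCube d, ∀ i,
      |f t - ∑ j, φ j (t i) * f (Function.update t i (y j))| ≤ ε) (S : Finset (Fin d)) :
    ∃ (ι : Type) (_ : Fintype ι) (p : ι → (Fin d → ℝ) → (Fin d → ℝ)) (w : ι → (Fin d → ℝ) → ℝ),
      Fintype.card ι = Fintype.card κ ^ S.card ∧ (∀ J, Measurable (p J)) ∧
      (∀ J, ∀ t ∈ unitCube d, p J t ∈ unitCube d) ∧
      (∀ J t t', ∀ i ∈ S, p J t i = p J t' i) ∧ (∀ J, Measurable (w J)) ∧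
      (∀ t ∈ unitCube d, ∑ J, |w J t| ≤ Λ ^ S.card) ∧
      ∀ f ∈ F, ∀ t ∈ unitCube d, |f t - ∑ J, w J t * f (p J t)| ≤ S.card * Λ ^ S.card * ε := by
  classical
  have hΛ0 : 0 ≤ Λ := zero_le_one.trans hΛ
  induction S using Finset.induction_on with
  | empty =>
    exact ⟨Unit, inferInstance, fun _ t => t, fun _ _ => 1, by simp, fun _ => measurable_id,
      fun _ t ht => ht, by simp, fun _ => measurable_const, by simp, by simp⟩
  | insert i S hi ih =>
    obtain ⟨ι, _, p, w, hcard, hpm, hpD, hpS, hwm, hwsum, herr⟩ := ih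
    refine ⟨ι × κ, inferInstance, fun J t => Function.update (p J.1 t) i (y J.2),
      fun J t => w J.1 t * φ J.2 (p J.1 t i), ?_, fun J => ?_, fun J t ht => ?_,
      fun J t t' l hl => ?_, fun J => ?_, fun t ht => ?_, fun f hf t ht => ?_⟩
    · rw [Fintype.card_prod, hcard, Finset.card_insert_of_notMem hi, pow_succ]
    · refine measurable_pi_iff.2 fun l => ?_
      rcases eq_or_ne l i with rfl | hl
      · simp
      · simpa [hl] using measurable_pi_iff.1 (hpm J.1) l
    · exact update_mem_unitCube (hpD _ _ ht) i (hy _)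
    · rcases eq_or_ne l i with rfl | hne
      · simp
      · simpa [hne] using hpS J.1 t t' l (Finset.mem_of_mem_insert_of_ne hl hne)
    · exact (hwm _).mul ((hφ _).comp (measurable_pi_iff.1 (hpm _) i))
    · rw [Fintype.sum_prod_type, Finset.card_insert_of_notMem hi, pow_succ]
      calc ∑ J, ∑ j, |w J t * φ j (p J t i)| = ∑ J, |w J t| * ∑ j, |φ j (p J t i)| := by
            simp only [abs_mul, Finset.mul_sum]
        _ ≤ ∑ J, |w J t| * Λ := Finset.sum_le_sum fun J _ =>
            mul_le_mul_of_nonneg_left (hsum _ (hpD J t ht i trivial)) (abs_nonneg _)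
        _ ≤ Λ ^ S.card * Λ := by
            rw [← Finset.sum_mul]
            exact mul_le_mul_of_nonneg_right (hwsum t ht) hΛ0
    · have hsplit : f t - ∑ J : ι × κ, w J.1 t * φ J.2 (p J.1 t i) *
            f (Function.update (p J.1 t) i (y J.2))
          = (f t - ∑ J, w J t * f (p J t)) + ∑ J, w J t *
            (f (p J t) - ∑ j, φ j (p J t i) * f (Function.update (p J t) i (y j))) := by
        simp only [Fintype.sum_prod_type, mul_sub, Finset.sum_sub_distrib, Finset.mul_sum, mul_assoc]
        ring
      have hsecond : |∑ J, w J t *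
            (f (p J t) - ∑ j, φ j (p J t i) * f (Function.update (p J t) i (y j)))|
          ≤ Λ ^ S.card * ε := by
        refine (Finset.abs_sum_le_sum_abs _ _).trans ?_
        calc _ ≤ ∑ J, |w J t| * ε := Finset.sum_le_sum fun J _ => by
              rw [abs_mul]
              exact mul_le_mul_of_nonneg_left (happ f hf _ (hpD J t ht) i) (abs_nonneg _)
          _ ≤ Λ ^ S.card * ε := by
              rw [← Finset.sum_mul]
              exact mul_le_mul_of_nonneg_right (hwsum t ht) hε
      rw [hsplit, Finset.card_insert_of_notMem hi]
      calc _ ≤ S.card * Λ ^ S.card * ε + Λ ^ S.card * ε :=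
            (abs_add_le _ _).trans (add_le_add (herr f hf t ht) hsecond)
        _ = ((S.card + 1 : ℕ) : ℝ) * Λ ^ S.card * ε := by push_cast; ring
        _ ≤ ((S.card + 1 : ℕ) : ℝ) * Λ ^ (S.card + 1) * ε := by
            gcongr
            exact Nat.le_succ _

/-- A deterministic linear `L^∞`-approximation on `F^k_d` based on `(m * k) ^ d` function values. -/
lemma exists_deterministic_approximation {k d m : ℕ} (hk : 0 < k) (hm : 0 < m) {Λ : ℝ}
    (hΛ : Λ = k * (k + 1 : ℝ) ^ (k - 1)) :
    ∃ (ι : Type) (_ : Fintype ι) (z : ι → Fin d → ℝ) (w : ι → (Fin d → ℝ) → ℝ),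
      Fintype.card ι = (m * k) ^ d ∧ (∀ J, z J ∈ unitCube d) ∧ (∀ J, Measurable (w J)) ∧
      (∀ J, ∀ t ∈ unitCube d, |w J t| ≤ Λ ^ d) ∧
      ∀ f ∈ Fkd k d (unitCube d), ∀ t ∈ unitCube d,
        |f t - ∑ J, w J t * f (z J)| ≤ d * Λ ^ d * ((1 + Λ) * ((m : ℝ)⁻¹) ^ k) := by
  obtain ⟨q, rfl⟩ : ∃ q, k = q + 1 := ⟨k - 1, by omega⟩
  have hΛ' : Λ = (q + 1) * (q + 2 : ℝ) ^ q := by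
    rw [hΛ]; push_cast [add_tsub_cancel_right]; ring
  have hq0 : (0 : ℝ) ≤ q := q.cast_nonneg
  have hΛ1 : 1 ≤ Λ := by
    rw [hΛ']
    exact one_le_mul_of_one_le_of_one_le (by linarith) (one_le_pow₀ (by linarith))
  obtain ⟨y, φ, hy, hφ, hsum, happ⟩ := exists_piecewise_interpolation q m hm
  rw [← hΛ'] at hsum happ
  obtain ⟨ι, hι, p, w, hcard, -, hpD, hpS, hwm, hwsum, herr⟩ :=
    exists_tensor_approximation (d := d) (ε := (1 + Λ) * ((m : ℝ)⁻¹) ^ (q + 1)) hΛ1 (by positivity)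
      (Fkd (q + 1) d (unitCube d)) hy hφ hsum (fun f hf t ht i => by
        have hc : ContDiffOn ℝ (q + 1) (fun s => f (Function.update t i s)) (Set.Ioo 0 1) := by
          exact_mod_cast contDiffOn_slice hf.1 ht i
        have := happ _ hc (fun s hs => by
          rw [iteratedDeriv_slice hf.1 ht i hs, ← mderiv_single]
          exact hf.2 _ (by simp) _ (update_mem_unitCube ht i hs)) (t i) (ht i trivial)
        simpa using this) Finset.univ
  have hhalf : (fun _ => 1 / 2 : Fin d → ℝ) ∈ unitCube d := fun _ _ => by norm_num
  refine ⟨ι, hι, fun J => p J fun _ => 1 / 2, w, ?_, fun J => hpD J _ hhalf, hwm, ?_, ?_⟩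
  · rw [hcard]; simp
  · intro J t ht
    have := hwsum t ht
    rw [Finset.card_univ, Fintype.card_fin] at this
    exact (Finset.single_le_sum (f := fun J => |w J t|) (fun _ _ => abs_nonneg _)
      (Finset.mem_univ J)).trans this
  · intro f hf t ht
    have := herr f hf t ht
    rw [Finset.card_univ, Fintype.card_fin] at this
    convert this using 6 with J
    exact funext fun i => hpS J _ _ i (Finset.mem_univ i)

/-- Mean absolute error of the standard Monte Carlo estimator for a bounded integrand. -/
lemma lintegral_abs_integral_sub_average_le {X : Type*} [MeasurableSpace X] (ν : Measure X)
    [IsProbabilityMeasure ν] {g : X → ℝ} (hg : Measurable g) {B : ℝ} (hB : ∀ x, |g x| ≤ B)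
    {N : ℕ} (hN : 0 < N) :
    ∫⁻ ω : Fin N → X, ENNReal.ofReal |(∫ x, g x ∂ν) - (N : ℝ)⁻¹ * ∑ l, g (ω l)|
        ∂(Measure.pi fun _ => ν)
      ≤ ENNReal.ofReal (B / √N) := by
  obtain ⟨x₀⟩ : Nonempty X := nonempty_of_isProbabilityMeasure ν
  have hB0 : 0 ≤ B := (abs_nonneg _).trans (hB x₀)
  have hN0 : (0 : ℝ) < N := by exact_mod_cast hN
  set P : Measure (Fin N → X) := Measure.pi fun _ => ν with hP
  have hgL : MemLp g 2 ν := MemLp.of_bound hg.aestronglyMeasurable B (ae_of_all _ hB)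
  set I := ∫ x, g x ∂ν with hI
  set Y : (Fin N → X) → ℝ := ∑ l : Fin N, fun ω => g (ω l) with hY
  have hYapp : ∀ ω, Y ω = ∑ l, g (ω l) := fun ω => by simp [hY]
  have hcoord : ∀ l : Fin N, MemLp (fun ω : Fin N → X => g (ω l)) 2 P := fun l =>
    hgL.comp_measurePreserving (measurePreserving_eval (fun _ => ν) l)
  have hYL : MemLp Y 2 P := memLp_finsetSum' _ fun l _ => hcoord l
  have hYmean : ∫ ω, Y ω ∂P = N * I := by
    simp only [hYapp]
    rw [integral_finsetSum _ fun l _ => (hcoord l).integrable one_le_two]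
    have : ∀ l : Fin N, ∫ ω, g (ω l) ∂P = I := fun l => by
      rw [hI, ← (measurePreserving_eval (fun _ : Fin N => ν) l).map_eq,
        integral_map (measurable_pi_apply l).aemeasurable hg.aestronglyMeasurable]
    simp [this]
  have hvar : ProbabilityTheory.variance Y P ≤ N * B ^ 2 := by
    rw [hY, hP, ProbabilityTheory.variance_sum_pi fun _ => hgL]
    have h1 : ProbabilityTheory.variance g ν ≤ B ^ 2 := by
      refine (ProbabilityTheory.variance_le_expectation_sq hg.aestronglyMeasurable).trans ?_
      refine (integral_mono hgL.integrable_sq (integrable_const (B ^ 2)) fun x => ?_).trans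
        (by simp)
      exact sq_le_sq' (abs_le.1 (hB x)).1 (abs_le.1 (hB x)).2
    calc _ ≤ ∑ _l : Fin N, B ^ 2 := Finset.sum_le_sum fun _ _ => h1
      _ = N * B ^ 2 := by simp
  set Z : (Fin N → X) → ℝ := fun ω => |Y ω - N * I| with hZ
  have hZL : MemLp Z 2 P := (hYL.sub (memLp_const (N * I))).abs
  have hsq : (∫ ω, Z ω ∂P) ^ 2 ≤ N * B ^ 2 := by
    have h1 := ProbabilityTheory.variance_nonneg Z P
    rw [ProbabilityTheory.variance_eq_sub hZL] at h1
    have h2 : ∫ ω, (Z ^ 2) ω ∂P = ProbabilityTheory.variance Y P := by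
      rw [ProbabilityTheory.variance_eq_integral hYL.aestronglyMeasurable.aemeasurable, hYmean]
      simp [hZ]
    linarith
  have hZle : ∫ ω, Z ω ∂P ≤ √N * B := by
    refine abs_le_of_sq_le_sq' ?_ (by positivity) |>.2
    rwa [mul_pow, Real.sq_sqrt hN0.le]
  have hfun : ∀ ω : Fin N → X, |I - (N : ℝ)⁻¹ * ∑ l, g (ω l)| = (N : ℝ)⁻¹ * Z ω := by
    intro ω
    have : I - (N : ℝ)⁻¹ * ∑ l, g (ω l) = -((N : ℝ)⁻¹ * (Y ω - N * I)) := by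
      rw [hYapp]; field_simp; ring
    rw [this, abs_neg, abs_mul, abs_of_pos (inv_pos.2 hN0)]
  simp only [hfun]
  rw [← ofReal_integral_eq_lintegral_ofReal ((hZL.integrable one_le_two).const_mul _)
    (ae_of_all _ fun ω => mul_nonneg (inv_pos.2 hN0).le (abs_nonneg _)), integral_const_mul]
  refine ENNReal.ofReal_le_ofReal ?_
  calc (N : ℝ)⁻¹ * ∫ ω, Z ω ∂P ≤ (N : ℝ)⁻¹ * (√N * B) := by gcongr
    _ = B / √N := by
      have h : √(N : ℝ) ≠ 0 := (Real.sqrt_pos.2 hN0).ne'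
      nth_rw 1 [← Real.sq_sqrt hN0.le]
      field_simp

lemma volume_unitCube (d : ℕ) : volume (unitCube d) = 1 := by
  simp [unitCube, volume_pi_pi]

/-- Separation of the main part: a deterministic linear approximation of the integrand combined
with the Monte Carlo estimator for the integral of the remainder. -/
lemma exists_randomized_quadrature_of_approximation {d n N : ℕ} (hN : 0 < N) {ι : Type} [Fintype ι]
    (hn : Fintype.card ι + N = n) {z : ι → Fin d → ℝ} {w : ι → (Fin d → ℝ) → ℝ} {W B : ℝ}
    (hz : ∀ J, z J ∈ unitCube d) (hw : ∀ J, Measurable (w J))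
    (hW : ∀ J, ∀ t ∈ unitCube d, |w J t| ≤ W) :
    ∃ (Ω : Type) (_ : MeasurableSpace Ω) (μ : Measure Ω),
      IsProbabilityMeasure μ ∧
      ∃ (x : Fin n → Ω → (Fin d → ℝ)) (a : Fin n → Ω → ℝ),
        (∀ i, Measurable (x i)) ∧ (∀ i, Measurable (a i)) ∧
        (∀ i ω, x i ω ∈ unitCube d) ∧
        ∀ f : (Fin d → ℝ) → ℝ, ContinuousOn f (unitCube d) →
          (∀ t ∈ unitCube d, |f t - ∑ J, w J t * f (z J)| ≤ B) →
          (∫⁻ ω, ENNReal.ofReal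
              |(∫ t in unitCube d, f t) - ∑ i, a i ω * f (x i ω)| ∂μ)
            ≤ ENNReal.ofReal (B / √N) := by
  have hD : MeasurableSet (unitCube d) := (isOpen_unitCube d).measurableSet
  let ν : Measure (unitCube d) := volume.comap Subtype.val
  have hν : IsProbabilityMeasure ν :=
    ⟨by simp [ν, comap_subtype_coe_apply hD, volume_unitCube]⟩
  let e : Fin n ≃ ι ⊕ Fin N := Fintype.equivOfCardEq (by simp [hn])
  let x : ι ⊕ Fin N → (Fin N → unitCube d) → (Fin d → ℝ) :=
    Sum.elim (fun J _ => z J) fun l ω => ω l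
  let a : ι ⊕ Fin N → (Fin N → unitCube d) → ℝ :=
    Sum.elim (fun J ω => (∫ t : unitCube d, w J t ∂ν) - (N : ℝ)⁻¹ * ∑ l, w J (ω l))
      fun _ _ => (N : ℝ)⁻¹
  have hx : ∀ s, Measurable (x s) := by
    rintro (J | l)
    · exact measurable_const
    · exact measurable_subtype_coe.comp (measurable_pi_apply l)
  have ha : ∀ s, Measurable (a s) := by
    rintro (J | l)
    · refine measurable_const.sub (measurable_const.mul ?_)
      exact Finset.measurable_fun_sum _ fun l _ =>
        (hw J).comp (measurable_subtype_coe.comp (measurable_pi_apply l))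
    · exact measurable_const
  have hxD : ∀ s ω, x s ω ∈ unitCube d := by
    rintro (J | l) ω
    · exact hz J
    · exact (ω l).2
  refine ⟨Fin N → unitCube d, inferInstance, Measure.pi fun _ => ν, inferInstance,
    fun i => x (e i), fun i => a (e i), fun i => hx _, fun i => ha _, fun i => hxD _, ?_⟩
  · intro f hf hfB
    set g : unitCube d → ℝ := fun t => f t - ∑ J, w J t * f (z J) with hg
    have hfm : Measurable fun t : unitCube d => f t := hf.domRestrict.measurable
    have hwm : ∀ J, Measurable fun t : unitCube d => w J t := fun J =>
      (hw J).comp measurable_subtype_coe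
    have hwi : ∀ J, Integrable (fun t : unitCube d => w J t) ν := fun J =>
      Integrable.of_bound (hwm J).aestronglyMeasurable W (ae_of_all _ fun t => hW J t t.2)
    have hsumm : Measurable fun t : unitCube d => ∑ J, w J t * f (z J) :=
      Finset.measurable_fun_sum _ fun J _ => (hwm J).mul_const _
    have hgm : Measurable g := hfm.sub hsumm
    have hgi : Integrable g ν :=
      Integrable.of_bound hgm.aestronglyMeasurable B (ae_of_all _ fun t => hfB t t.2)
    have hsumi : Integrable (fun t : unitCube d => ∑ J, w J t * f (z J)) ν :=
      integrable_finsetSum _ fun J _ => (hwi J).mul_const _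
    have hint : ∫ t in unitCube d, f t
        = (∫ t, g t ∂ν) + ∑ J, (∫ t : unitCube d, w J t ∂ν) * f (z J) := by
      rw [← integral_subtype_comap hD f]
      have h1 : ∀ t : unitCube d, f t = g t + ∑ J, w J t * f (z J) := fun t => by simp [hg]
      rw [integral_congr_ae (ae_of_all _ h1), integral_add hgi hsumi,
        integral_finsetSum _ fun J _ => (hwi J).mul_const _]
      simp only [integral_mul_const]
    have hkey : ∀ ω : Fin N → unitCube d,
        (∫ t in unitCube d, f t) - ∑ i, a (e i) ω * f (x (e i) ω)
          = (∫ t, g t ∂ν) - (N : ℝ)⁻¹ * ∑ l, g (ω l) := by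
      intro ω
      rw [Equiv.sum_comp e fun s => a s ω * f (x s ω), Fintype.sum_sum_type, hint]
      simp only [a, x, Sum.elim_inl, Sum.elim_inr, hg, sub_mul, Finset.sum_sub_distrib,
        Finset.mul_sum, mul_sub, Finset.sum_mul]
      rw [Finset.sum_comm]
      simp only [mul_assoc]
      ring
    simp only [hkey]
    exact lintegral_abs_integral_sub_average_le ν hgm (fun t => hfB t t.2) hN

lemma abs_setIntegral_unitCube_le_one {k d : ℕ} {f : (Fin d → ℝ) → ℝ}
    (hf : f ∈ Fkd k d (unitCube d)) : |∫ t in unitCube d, f t| ≤ 1 := by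
  have h := norm_setIntegral_le_of_norm_le_const (μ := volume) (s := unitCube d) (f := f) (C := 1)
    (by simp [volume_unitCube]) fun t ht => by
      have := hf.2 0 (by simp) t ht
      rwa [mderiv_zero] at this
  simpa [Measure.real, volume_unitCube] using h

/-- The partition size for a budget of `n` function values. -/
lemma exists_partition_size {k d n : ℕ} (hk : 0 < k) (hd : 0 < d) (hn : 2 * k ^ d ≤ n) :
    ∃ m, 0 < m ∧ 2 * (m * k) ^ d ≤ n ∧ n < 2 * (2 * m * k) ^ d := by
  classical
  have hex : ∃ m, n < 2 * ((m + 1) * k) ^ d := by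
    refine ⟨n, ?_⟩
    have h1 : n + 1 ≤ (n + 1) * k := Nat.le_mul_of_pos_right _ hk
    have h2 : (n + 1) * k ≤ ((n + 1) * k) ^ d := Nat.le_self_pow hd.ne' _
    omega
  have hspec := Nat.find_spec hex
  have hmin := fun j => Nat.find_min (m := j) hex
  set m := Nat.find hex
  have hm : 0 < m := by
    by_contra h0
    have : m = 0 := by omega
    rw [this] at hspec
    simp at hspec
    omega
  refine ⟨m, hm, ?_, hspec.trans_le ?_⟩
  · have := hmin (m - 1) (by omega)
    rw [Nat.sub_add_cancel hm] at this
    omega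
  · gcongr
    omega

/-- Upper-bound half of Bakhvalov's theorem on randomized quadrature: for all `k, d` there is
`C > 0` such that for every `n ≥ 1` there is a randomized linear quadrature formula with `n`
nodes in `(0,1)^d` whose expected error on all of `F^k_d` is at most `C n^{-k/d-1/2}`. -/
theorem randomized_quadrature_upper_bound (k d : ℕ) (hk : 0 < k) (hd : 0 < d) :
    ∃ C : ℝ, 0 < C ∧ ∀ n : ℕ, 0 < n →
      ∃ (Ω : Type) (mΩ : MeasurableSpace Ω) (μ : Measure Ω),
        IsProbabilityMeasure μ ∧
        ∃ (x : Fin n → Ω → (Fin d → ℝ)) (a : Fin n → Ω → ℝ),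
          (∀ i, Measurable (x i)) ∧ (∀ i, Measurable (a i)) ∧
          (∀ i ω, x i ω ∈ unitCube d) ∧
          ∀ f ∈ Fkd k d (unitCube d),
            (∫⁻ ω, ENNReal.ofReal
                |(∫ t in unitCube d, f t) - ∑ i, a i ω * f (x i ω)| ∂μ)
              ≤ ENNReal.ofReal (C * (n : ℝ) ^ (-(k : ℝ) / d - 1 / 2)) := by
  set Λ : ℝ := k * (k + 1 : ℝ) ^ (k - 1) with hΛ
  have hΛ0 : 0 ≤ Λ := by positivity
  have hd0 : (0 : ℝ) < d := by exact_mod_cast hd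
  set E : ℝ := d * Λ ^ d * (1 + Λ) with hE
  have hE0 : 0 ≤ E := by positivity
  set r : ℝ := k / d with hr
  have hr0 : 0 ≤ r := by positivity
  set C₁ : ℝ := 2 ^ r * (2 * k : ℝ) ^ k with hC₁
  have hC₁0 : 0 ≤ C₁ := by positivity
  set C₂ : ℝ := ((2 * k ^ d : ℕ) : ℝ) ^ (r + 1 / 2) with hC₂
  have hC₂0 : 0 < C₂ := by positivity
  have hexp : -(k : ℝ) / d - 1 / 2 = -(r + 1 / 2) := by rw [hr]; ring
  refine ⟨C₂ + E * C₁ * √2, by positivity, fun n hn => ?_⟩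
  have hn0 : (0 : ℝ) < n := by exact_mod_cast hn
  rw [hexp]
  rcases lt_or_ge n (2 * k ^ d) with hsmall | hlarge
  · refine ⟨Unit, inferInstance, Measure.dirac (), inferInstance, fun _ _ _ => 1 / 2,
      fun _ _ => 0, fun _ => measurable_const, fun _ => measurable_const,
      fun _ _ _ _ => by norm_num, fun f hf => ?_⟩
    simp only [zero_mul, Finset.sum_const_zero, sub_zero, lintegral_const, measure_univ, mul_one]
    refine ENNReal.ofReal_le_ofReal ((abs_setIntegral_unitCube_le_one hf).trans ?_)
    rw [Real.rpow_neg hn0.le, ← div_eq_mul_inv, one_le_div (by positivity)]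
    have h1 : (n : ℝ) ^ (r + 1 / 2) ≤ C₂ :=
      Real.rpow_le_rpow hn0.le (by exact_mod_cast hsmall.le) (by positivity)
    have h2 : 0 ≤ E * C₁ * √2 := by positivity
    linarith
  · obtain ⟨m, hm, hmn, hnm⟩ := exists_partition_size hk hd hlarge
    have hm0 : (0 : ℝ) < m := by exact_mod_cast hm
    obtain ⟨ι, _, z, w, hcard, hz, hw, hW, happ⟩ :=
      exists_deterministic_approximation (d := d) hk hm hΛ
    have hMpos : 0 < (m * k) ^ d := by positivity
    obtain ⟨N, hN⟩ : ∃ N, (m * k) ^ d + N = n := ⟨n - (m * k) ^ d, by omega⟩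
    have hNpos : 0 < N := by omega
    have hN2 : (n : ℝ) ≤ 2 * N := by exact_mod_cast (by omega : n ≤ 2 * N)
    obtain ⟨Ω, mΩ, μ, hμ, x, a, hx, ha, hxD, hquad⟩ :=
      exists_randomized_quadrature_of_approximation (n := n) hNpos (by rw [hcard, hN])
        (B := d * Λ ^ d * ((1 + Λ) * ((m : ℝ)⁻¹) ^ k)) hz hw hW
    refine ⟨Ω, mΩ, μ, hμ, x, a, hx, ha, hxD, fun f hf =>
      (hquad f hf.1.continuousOn (happ f hf)).trans (ENNReal.ofReal_le_ofReal ?_)⟩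
    have hmesh : ((m : ℝ)⁻¹) ^ k ≤ C₁ * (n : ℝ) ^ (-r) := by
      have h1 : (n : ℝ) ^ r ≤ C₁ * (m : ℝ) ^ k := by
        have h2 : (n : ℝ) ≤ 2 * (2 * m * k : ℝ) ^ d := by exact_mod_cast hnm.le
        calc (n : ℝ) ^ r ≤ (2 * (2 * m * k : ℝ) ^ d) ^ r := Real.rpow_le_rpow hn0.le h2 hr0
          _ = 2 ^ r * (2 * m * k : ℝ) ^ k := by
            rw [Real.mul_rpow (by norm_num) (by positivity), ← Real.rpow_natCast _ d,
              ← Real.rpow_mul (by positivity), hr, mul_div_cancel₀ _ hd0.ne', Real.rpow_natCast]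
          _ = C₁ * (m : ℝ) ^ k := by rw [hC₁, mul_assoc (2 ^ r), ← mul_pow]; ring
      rw [Real.rpow_neg hn0.le, inv_pow, ← div_eq_mul_inv, le_div_iff₀ (by positivity),
        inv_mul_le_iff₀ (by positivity), mul_comm]
      exact h1
    have hsqrt : 1 / √(N : ℝ) ≤ √2 * (n : ℝ) ^ (-(1 / 2) : ℝ) := by
      have hN0 : (0 : ℝ) < N := by exact_mod_cast hNpos
      rw [Real.rpow_neg hn0.le, ← Real.sqrt_eq_rpow, ← div_eq_mul_inv,
        div_le_div_iff₀ (Real.sqrt_pos.2 hN0) (Real.sqrt_pos.2 hn0), one_mul,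
        ← Real.sqrt_mul (by norm_num)]
      exact Real.sqrt_le_sqrt hN2
    calc d * Λ ^ d * ((1 + Λ) * ((m : ℝ)⁻¹) ^ k) / √N
        = E * ((m : ℝ)⁻¹) ^ k * (1 / √N) := by rw [hE]; ring
      _ ≤ E * (C₁ * (n : ℝ) ^ (-r)) * (√2 * (n : ℝ) ^ (-(1 / 2) : ℝ)) := by gcongr
      _ = E * C₁ * √2 * (n : ℝ) ^ (-(r + 1 / 2)) := by
        rw [neg_add, Real.rpow_add hn0]; ring
      _ ≤ (C₂ + E * C₁ * √2) * (n : ℝ) ^ (-(r + 1 / 2)) := by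
        gcongr
        linarith
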